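/- arXiv:1502.00414 — 7 statements merged into one kernel-verified Lean document; each statement's English description precedes it below -/
import Mathlib

section
/- Let X be a uniformly convex Banach space, let (x_k) be a bounded sequence in X that Δ-converges to a point x ∈ X, and let z ∈ X with z ≠ x. Then there exist an index k₀ and a constant c > 0 such that ‖x_k − x‖ ≤ ‖x_k − z‖ − c for all k ≥ k₀. -/
open Filter Topology

/-- A sequence `x` in a normed space `Δ`-converges to `a` if for every `y`,
`limsup (‖x k - a‖ - ‖x k - y‖) ≤ 0`, i.e. for every `ε > 0` eventually
`‖x k - a‖ ≤ ‖x k - y‖ + ε`. -/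
def DeltaConv {X : Type*} [NormedAddCommGroup X] (x : ℕ → X) (a : X) : Prop :=
  ∀ y : X, ∀ ε > (0 : ℝ), ∀ᶠ k in atTop, ‖x k - a‖ ≤ ‖x k - y‖ + ε

/-- In a uniformly convex space, midpoints of `d`-separated vectors of norm at most `R` are shorter
than the longer of the two vectors, by an amount that depends only on `d` and `R`. -/
theorem exists_norm_add_le_two_mul_max_sub {X : Type*} [NormedAddCommGroup X] [NormedSpace ℝ X]
    [UniformConvexSpace X] {d R : ℝ} (hd : 0 < d) (hR : 0 < R) :
    ∃ η > 0, ∀ u v : X, ‖u‖ ≤ R → ‖v‖ ≤ R → d ≤ ‖u - v‖ →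
      ‖u + v‖ ≤ 2 * max ‖u‖ ‖v‖ - η := by
  obtain ⟨δ, hδ, h⟩ := exists_forall_closed_ball_dist_add_le_two_sub X (div_pos hd hR)
  refine ⟨d / 2 * δ, by positivity, fun u v hu hv huv => ?_⟩
  set s := max ‖u‖ ‖v‖ with hs
  have hus : ‖u‖ ≤ s := le_max_left _ _
  have hvs : ‖v‖ ≤ s := le_max_right _ _
  have hds : d / 2 ≤ s := by linarith [norm_sub_le u v]
  have hs0 : 0 < s := by linarith
  have hsR : s ≤ R := max_le hu hv
  have norm_smul_inv (w : X) : ‖s⁻¹ • w‖ = ‖w‖ / s := by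
    rw [norm_smul, norm_inv, Real.norm_of_nonneg hs0.le, inv_mul_eq_div]
  have key := h (x := s⁻¹ • u) (by rw [norm_smul_inv]; exact div_le_one_of_le₀ hus hs0.le)
    (y := s⁻¹ • v) (by rw [norm_smul_inv]; exact div_le_one_of_le₀ hvs hs0.le)
    (by rw [← smul_sub, norm_smul_inv]; gcongr)
  rw [← smul_add, norm_smul_inv, div_le_iff₀ hs0] at key
  nlinarith [mul_le_mul_of_nonneg_right hds hδ.le]

theorem stmt_0 {X : Type*} [NormedAddCommGroup X] [NormedSpace ℝ X]
    [UniformConvexSpace X] [CompleteSpace X]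
    (x : ℕ → X) (hb : ∃ C : ℝ, ∀ k, ‖x k‖ ≤ C)
    (a : X) (hx : DeltaConv x a) (z : X) (hz : z ≠ a) :
    ∃ (k₀ : ℕ) (c : ℝ), 0 < c ∧ ∀ k ≥ k₀, ‖x k - a‖ ≤ ‖x k - z‖ - c := by
  obtain ⟨C, hC⟩ := hb
  have hd : 0 < ‖z - a‖ := norm_pos_iff.2 (sub_ne_zero.2 hz)
  have hC0 : 0 ≤ C := (norm_nonneg _).trans (hC 0)
  have hR : 0 < C + ‖a‖ + ‖z‖ := by linarith [norm_sub_le z a]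
  obtain ⟨η, hη, h⟩ := exists_norm_add_le_two_mul_max_sub (X := X) hd hR
  obtain ⟨k₀, hk₀⟩ := eventually_atTop.1 (hx (midpoint ℝ a z) (η / 4) (by positivity))
  refine ⟨k₀, η / 4, by positivity, fun k hk => ?_⟩
  have hsum := h (x k - a) (x k - z)
    (by linarith [norm_sub_le (x k) a, hC k, norm_nonneg z])
    (by linarith [norm_sub_le (x k) z, hC k, norm_nonneg a])
    (by rw [sub_sub_sub_cancel_left])
  have hmid : ‖(x k - a) + (x k - z)‖ = 2 * ‖x k - midpoint ℝ a z‖ := by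
    have : (x k - a) + (x k - z) = (2 : ℝ) • (x k - midpoint ℝ a z) := by
      rw [midpoint_eq_smul_add, invOf_eq_inv]
      module
    rw [this, norm_smul, Real.norm_ofNat]
  have hk' := hk₀ k hk
  rcases max_cases ‖x k - a‖ ‖x k - z‖ with ⟨hm, _⟩ | ⟨hm, _⟩ <;> rw [hm] at hsum <;> linarith
end

section
/- In a uniformly convex Banach space X, the Δ-limit of a bounded sequence is unique: if a bounded sequence (x_k) Δ-converges to x and also Δ-converges to x′, then x = x′. -/
open Filter Topology

/-- In a uniformly convex space, if `‖u‖, ‖v‖ ≤ R` and `ε ≤ ‖u - v‖`, then `‖u + v‖` is smaller than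
`2 * max ‖u‖ ‖v‖` by an amount depending only on `ε` and `R`. -/
theorem exists_forall_norm_add_le_two_mul_max_sub (X : Type*) [NormedAddCommGroup X]
    [NormedSpace ℝ X] [UniformConvexSpace X] {ε R : ℝ} (hε : 0 < ε) (hR : 0 < R) :
    ∃ δ, 0 < δ ∧ ∀ ⦃u : X⦄, ‖u‖ ≤ R → ∀ ⦃v : X⦄, ‖v‖ ≤ R → ε ≤ ‖u - v‖ →
      ‖u + v‖ ≤ 2 * max ‖u‖ ‖v‖ - δ := by
  obtain ⟨δ, hδ, H⟩ := exists_forall_closed_ball_dist_add_le_two_sub X (div_pos hε hR)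
  refine ⟨δ * (ε / 2), by positivity, fun u hu v hv huv => ?_⟩
  set r := max ‖u‖ ‖v‖
  have hur : ‖u‖ ≤ r := le_max_left _ _
  have hvr : ‖v‖ ≤ r := le_max_right _ _
  have hεr : ε / 2 ≤ r := by linarith [norm_sub_le u v]
  have hr : 0 < r := by linarith
  have hrR : r ≤ R := max_le hu hv
  have hscale (w : X) : ‖r⁻¹ • w‖ = ‖w‖ / r := by
    rw [norm_smul_of_nonneg (inv_nonneg.2 hr.le), div_eq_inv_mul]
  have key : ‖r⁻¹ • u + r⁻¹ • v‖ ≤ 2 - δ := by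
    refine H ?_ ?_ ?_
    · rwa [hscale, div_le_one hr]
    · rwa [hscale, div_le_one hr]
    · rw [← smul_sub, hscale]
      gcongr
  rw [← smul_add, hscale, div_le_iff₀ hr] at key
  linarith [mul_le_mul_of_nonneg_left hεr hδ.le]

theorem stmt_1 {X : Type*} [NormedAddCommGroup X] [NormedSpace ℝ X]
    [UniformConvexSpace X] [CompleteSpace X]
    (x : ℕ → X) (hb : ∃ C : ℝ, ∀ k, ‖x k‖ ≤ C)
    (a a' : X) (h : DeltaConv x a) (h' : DeltaConv x a') : a = a' := by
  by_contra hne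
  obtain ⟨C, hC⟩ := hb
  have hC0 : 0 ≤ C := (norm_nonneg _).trans (hC 0)
  have hR : 0 < C + ‖a‖ + ‖a'‖ + 1 := by positivity
  obtain ⟨δ, hδ, H⟩ := exists_forall_norm_add_le_two_mul_max_sub X
    (norm_pos_iff.2 (sub_ne_zero.2 hne)) hR
  obtain ⟨k, hk, hk'⟩ := ((h (midpoint ℝ a a') (δ / 4) (by positivity)).and
    (h' (midpoint ℝ a a') (δ / 4) (by positivity))).exists
  have hsum : ‖(x k - a) + (x k - a')‖ = 2 * ‖x k - midpoint ℝ a a'‖ := by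
    rw [← norm_smul_of_nonneg zero_le_two, smul_sub, two_smul ℝ (midpoint ℝ a a'),
      midpoint_add_self, two_smul]
    congr 1
    abel
  have hsub : ‖a - a'‖ ≤ ‖(x k - a) - (x k - a')‖ := by
    rw [sub_sub_sub_cancel_left, norm_sub_rev]
  have hadd := H (by linarith [norm_sub_le (x k) a, hC k, norm_nonneg a'])
    (by linarith [norm_sub_le (x k) a', hC k, norm_nonneg a]) hsub
  linarith [max_le hk hk']
end

section
/- Let X be a uniformly convex Banach space and let (x_k) be a bounded sequence in X. Then (x_k) has a subsequence that Δ-converges to some point of X. -/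
open Filter Topology

/-- A monotone real function bounded below by `0` on a preorder in which antitone sequences have
lower bounds admits an element below which it is constant. -/
theorem exists_forall_le_apply_le_of_antitone_seq {α : Type*} [Preorder α] (f : α → ℝ)
    (hf : Monotone f) (h0 : ∀ a, 0 ≤ f a)
    (hseq : ∀ s : ℕ → α, Antitone s → ∃ c, ∀ n, c ≤ s n) (a₀ : α) :
    ∃ c ≤ a₀, ∀ b ≤ c, f c ≤ f b := by
  have hbdd : ∀ a, BddBelow (f '' Set.Iic a) := fun a => ⟨0, by rintro _ ⟨b, -, rfl⟩; exact h0 b⟩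
  have hstep : ∀ (n : ℕ) (a : α), ∃ b ≤ a, f b < sInf (f '' Set.Iic a) + 1 / ((n : ℝ) + 1) := by
    intro n a
    have hne : (f '' Set.Iic a).Nonempty := ⟨f a, a, le_rfl, rfl⟩
    obtain ⟨_, ⟨b, hb, rfl⟩, hlt⟩ := exists_lt_of_csInf_lt hne
      (lt_add_of_pos_right _ (Nat.one_div_pos_of_nat (α := ℝ) (n := n)))
    exact ⟨b, hb, hlt⟩
  choose g hg_le hg using hstep
  let s : ℕ → α := fun n => Nat.rec a₀ g n
  have hs : Antitone s := antitone_nat_of_succ_le fun n => hg_le n (s n)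
  obtain ⟨c, hc⟩ := hseq s hs
  refine ⟨c, hc 0, fun b hb => le_of_forall_pos_le_add fun ε hε => ?_⟩
  obtain ⟨n, hn⟩ := exists_nat_one_div_lt hε
  have h1 : sInf (f '' Set.Iic (s n)) ≤ f b := csInf_le (hbdd _) ⟨b, hb.trans (hc n), rfl⟩
  have h2 : f c ≤ f (s (n + 1)) := hf (hc (n + 1))
  have h3 : f (s (n + 1)) < sInf (f '' Set.Iic (s n)) + 1 / ((n : ℝ) + 1) := hg n (s n)
  linarith

section AsymptoticRadius

variable {ι X : Type*} [NormedAddCommGroup X]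

/-- The radii of closed balls eventually containing `x` along `F`. -/
def eventualRadii (x : ι → X) (F : Filter ι) : Set ℝ :=
  {r | ∃ y, ∀ᶠ k in F, ‖x k - y‖ ≤ r}

/-- The asymptotic radius of `x` along `F`. -/
noncomputable def asymptoticRadius (x : ι → X) (F : Filter ι) : ℝ :=
  sInf (eventualRadii x F)

theorem nonneg_of_mem_eventualRadii {x : ι → X} {F : Filter ι} [F.NeBot] {r : ℝ}
    (hr : r ∈ eventualRadii x F) : 0 ≤ r := by
  obtain ⟨y, hy⟩ := hr
  obtain ⟨k, hk⟩ := hy.exists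
  exact (norm_nonneg _).trans hk

theorem eventualRadii_nonempty {x : ι → X} (hb : ∃ C : ℝ, ∀ k, ‖x k‖ ≤ C) (F : Filter ι) :
    (eventualRadii x F).Nonempty := by
  obtain ⟨C, hC⟩ := hb
  exact ⟨C, 0, Eventually.of_forall fun k => by simpa using hC k⟩

theorem asymptoticRadius_nonneg (x : ι → X) (F : Filter ι) [F.NeBot] :
    0 ≤ asymptoticRadius x F :=
  Real.sInf_nonneg fun _ => nonneg_of_mem_eventualRadii

theorem asymptoticRadius_le {x : ι → X} {F : Filter ι} [F.NeBot] {y : X} {r : ℝ}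
    (h : ∀ᶠ k in F, ‖x k - y‖ ≤ r) : asymptoticRadius x F ≤ r :=
  csInf_le ⟨0, fun _ => nonneg_of_mem_eventualRadii⟩ ⟨y, h⟩

theorem asymptoticRadius_mono {x : ι → X} (hb : ∃ C : ℝ, ∀ k, ‖x k‖ ≤ C) {F G : Filter ι}
    [F.NeBot] (h : F ≤ G) : asymptoticRadius x F ≤ asymptoticRadius x G :=
  csInf_le_csInf ⟨0, fun _ => nonneg_of_mem_eventualRadii⟩ (eventualRadii_nonempty hb G)
    fun _ ⟨y, hy⟩ => ⟨y, hy.filter_mono h⟩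

theorem exists_eventually_le_asymptoticRadius_add {x : ι → X} (hb : ∃ C : ℝ, ∀ k, ‖x k‖ ≤ C)
    (F : Filter ι) {ε : ℝ} (hε : 0 < ε) :
    ∃ y, ∀ᶠ k in F, ‖x k - y‖ ≤ asymptoticRadius x F + ε := by
  obtain ⟨r, ⟨y, hy⟩, hr⟩ := exists_lt_of_csInf_lt (eventualRadii_nonempty hb F)
    (lt_add_of_pos_right (asymptoticRadius x F) hε)
  exact ⟨y, hy.mono fun k hk => hk.trans hr.le⟩

/-- Almost-minimizers of the asymptotic radius are close to each other. -/
theorem exists_forall_almost_center_dist_lt [NormedSpace ℝ X] [UniformConvexSpace X] (x : ι → X)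
    (F : Filter ι) [F.NeBot] {η : ℝ} (hη : 0 < η) :
    ∃ ε > 0, ∀ y z : X, (∀ᶠ k in F, ‖x k - y‖ ≤ asymptoticRadius x F + ε) →
      (∀ᶠ k in F, ‖x k - z‖ ≤ asymptoticRadius x F + ε) → ‖y - z‖ < η := by
  set R := asymptoticRadius x F with hR
  rcases (asymptoticRadius_nonneg x F).eq_or_lt with h0 | hpos
  · refine ⟨η / 3, by positivity, fun y z hy hz => ?_⟩
    obtain ⟨k, hky, hkz⟩ := (hy.and hz).exists
    have h1 : ‖y - z‖ ≤ ‖x k - z‖ + ‖x k - y‖ := by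
      simpa using norm_sub_le (x k - z) (x k - y)
    linarith
  · rw [← hR] at hpos
    obtain ⟨δ, hδ, h⟩ := exists_forall_closed_ball_dist_add_le_two_sub X
      (show 0 < η / (R + 1) by positivity)
    refine ⟨min 1 (δ * R / 4), by positivity, fun y z hy hz => ?_⟩
    set ε := min 1 (δ * R / 4) with hε
    have hε1 : ε ≤ 1 := min_le_left _ _
    have hε2 : ε ≤ δ * R / 4 := min_le_right _ _
    have hε0 : 0 < ε := by positivity
    have hr : 0 < R + ε := by positivity
    by_contra! hyz
    have hmid : ∀ᶠ k in F, ‖x k - (2⁻¹ : ℝ) • (y + z)‖ ≤ 2⁻¹ * ((2 - δ) * (R + ε)) := by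
      filter_upwards [hy, hz] with k hky hkz
      have hscale : ∀ v : X, ‖(R + ε)⁻¹ • v‖ = ‖v‖ / (R + ε) := fun v => by
        rw [norm_smul, Real.norm_of_nonneg (by positivity), inv_mul_eq_div]
      have key := h (x := (R + ε)⁻¹ • (x k - y)) (by rw [hscale]; exact (div_le_one hr).2 hky)
        (y := (R + ε)⁻¹ • (x k - z)) (by rw [hscale]; exact (div_le_one hr).2 hkz)
        (by
          rw [← smul_sub, hscale, sub_sub_sub_cancel_left, norm_sub_rev]
          gcongr)
      rw [← smul_add, hscale, div_le_iff₀ hr] at key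
      have heq : x k - (2⁻¹ : ℝ) • (y + z) = (2⁻¹ : ℝ) • (x k - y + (x k - z)) := by module
      rw [heq, norm_smul, Real.norm_of_nonneg (by positivity)]
      gcongr
    have := asymptoticRadius_le hmid
    rw [← hR] at this
    nlinarith [mul_pos hδ hpos, mul_pos hδ hε0]

/-- Bounded families in uniformly convex Banach spaces have asymptotic centers. -/
theorem exists_asymptotic_center [NormedSpace ℝ X] [UniformConvexSpace X] [CompleteSpace X]
    {x : ι → X} (hb : ∃ C : ℝ, ∀ k, ‖x k‖ ≤ C) (F : Filter ι) [F.NeBot] :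
    ∃ a : X, ∀ ε > 0, ∀ᶠ k in F, ‖x k - a‖ ≤ asymptoticRadius x F + ε := by
  choose y hy using fun n : ℕ => exists_eventually_le_asymptoticRadius_add hb F
    (Nat.one_div_pos_of_nat (α := ℝ) (n := n))
  have hy' : ∀ ε > 0, ∃ N : ℕ, ∀ n ≥ N, ∀ᶠ k in F,
      ‖x k - y n‖ ≤ asymptoticRadius x F + ε := by
    intro ε hε
    obtain ⟨N, hN⟩ := exists_nat_one_div_lt hε
    refine ⟨N, fun n hn => (hy n).mono fun k hk => hk.trans ?_⟩
    have := Nat.one_div_le_one_div (α := ℝ) hn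
    linarith
  have hcauchy : CauchySeq y := by
    refine Metric.cauchySeq_iff.2 fun η hη => ?_
    obtain ⟨ε, hε, h⟩ := exists_forall_almost_center_dist_lt x F hη
    obtain ⟨N, hN⟩ := hy' ε hε
    exact ⟨N, fun m hm n hn => by
      rw [dist_eq_norm]
      exact h _ _ (hN m hm) (hN n hn)⟩
  obtain ⟨a, ha⟩ := cauchySeq_tendsto_of_complete hcauchy
  refine ⟨a, fun ε hε => ?_⟩
  obtain ⟨N, hN⟩ := hy' (ε / 2) (half_pos hε)
  obtain ⟨n, hn, hna⟩ :=
    ((eventually_ge_atTop N).and (ha.eventually (Metric.ball_mem_nhds a (half_pos hε)))).exists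
  filter_upwards [hN n hn] with k hk
  rw [dist_eq_norm] at hna
  have := norm_sub_le_norm_sub_add_norm_sub (x k) (y n) a
  linarith

/-- Every countably generated filter has a countably generated refinement along which the
asymptotic radius cannot be decreased by refining further. -/
theorem exists_regular_filter {x : ι → X} (hb : ∃ C : ℝ, ∀ k, ‖x k‖ ≤ C) (F₀ : Filter ι)
    [F₀.NeBot] [F₀.IsCountablyGenerated] :
    ∃ F ≤ F₀, F.NeBot ∧ F.IsCountablyGenerated ∧
      ∀ G ≤ F, G.NeBot → G.IsCountablyGenerated →
        asymptoticRadius x F ≤ asymptoticRadius x G := by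
  let α := {F : Filter ι // F.NeBot ∧ F.IsCountablyGenerated}
  obtain ⟨⟨F, hF, hF'⟩, hle, h⟩ := exists_forall_le_apply_le_of_antitone_seq
    (fun F : α => asymptoticRadius x F.1)
    (fun F G hFG => have := F.2.1; asymptoticRadius_mono hb hFG)
    (fun F => have := F.2.1; asymptoticRadius_nonneg x F.1)
    (fun s hs => by
      have : ∀ n, (s n).1.IsCountablyGenerated := fun n => (s n).2.2
      have hne : (⨅ n, (s n).1).NeBot :=
        iInf_neBot_of_directed' (Antitone.directed_ge (f := fun n => (s n).1) fun _ _ h => hs h)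
          fun n => (s n).2.1
      exact ⟨⟨⨅ n, (s n).1, hne, inferInstance⟩, fun n => iInf_le (fun n => (s n).1) n⟩)
    ⟨F₀, inferInstance, inferInstance⟩
  exact ⟨F, hle, hF, hF', fun G hG hG1 hG2 => h ⟨G, hG1, hG2⟩ hG⟩

end AsymptoticRadius

theorem stmt_2 {X : Type*} [NormedAddCommGroup X] [NormedSpace ℝ X]
    [UniformConvexSpace X] [CompleteSpace X]
    (x : ℕ → X) (hb : ∃ C : ℝ, ∀ k, ‖x k‖ ≤ C) :
    ∃ φ : ℕ → ℕ, StrictMono φ ∧ ∃ a : X, DeltaConv (x ∘ φ) a := by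
  obtain ⟨F, hF, _, _, hreg⟩ := exists_regular_filter hb atTop
  obtain ⟨a, ha⟩ := exists_asymptotic_center hb F
  have hΔ : ∀ y : X, ∀ ε > (0 : ℝ), ∀ᶠ k in F, ‖x k - a‖ ≤ ‖x k - y‖ + ε := by
    intro y ε hε
    by_contra hcon
    have hne : (F ⊓ 𝓟 {k | ¬ ‖x k - a‖ ≤ ‖x k - y‖ + ε}).NeBot :=
      frequently_mem_iff_neBot.1 (not_eventually.1 hcon)
    have hle := hreg _ inf_le_left hne inferInstance
    have hlt : asymptoticRadius x (F ⊓ 𝓟 {k | ¬ ‖x k - a‖ ≤ ‖x k - y‖ + ε}) ≤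
        asymptoticRadius x F - ε / 2 := by
      refine asymptoticRadius_le (y := y) (eventually_inf_principal.2 ?_)
      filter_upwards [ha (ε / 2) (half_pos hε)] with k hk hbad
      rw [not_le] at hbad
      linarith
    linarith
  obtain ⟨u, hu⟩ := exists_seq_tendsto F
  obtain ⟨ψ, hψ, huψ⟩ := strictMono_subseq_of_tendsto_atTop (hu.mono_right hF)
  exact ⟨u ∘ ψ, huψ, a, fun y ε hε => (hu.comp hψ.tendsto_atTop).eventually (hΔ y ε hε)⟩
end

section
/- Let X be a uniformly convex Banach space with modulus of convexity δ. If (u_k) is a sequence in X with ‖u_k‖ ≤ 1 for all k which Δ-converges to u ∈ X, then ‖u‖ < 2 and, for all sufficiently large k, ‖u_k‖ ≥ ‖u_k − u‖ + δ(‖u‖). -/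
open Filter Topology

/-- The modulus of convexity of a normed space `X`:
`δ(ε) = inf {1 - ‖(x+y)/2‖ : ‖x‖ = ‖y‖ = 1, ‖x - y‖ = ε}`. -/
noncomputable def modConv (X : Type*) [NormedAddCommGroup X] (ε : ℝ) : ℝ :=
  sInf {d : ℝ | ∃ x y : X, ‖x‖ = 1 ∧ ‖y‖ = 1 ∧ ‖x - y‖ = ε ∧ d = 1 - ‖x + y‖ / 2}

section

variable {X : Type*} [NormedAddCommGroup X]

lemma modConv_le {x y : X} (hx : ‖x‖ = 1) (hy : ‖y‖ = 1) :
    modConv X ‖x - y‖ ≤ 1 - ‖x + y‖ / 2 := by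
  refine csInf_le ⟨0, ?_⟩ ⟨x, y, hx, hy, rfl, rfl⟩
  rintro d ⟨p, q, hp, hq, -, rfl⟩
  linarith [norm_add_le p q]

lemma modConv_eq_zero_or_exists (ε : ℝ) :
    modConv X ε = 0 ∨ ∃ x y : X, ‖x‖ = 1 ∧ ‖y‖ = 1 ∧ ‖x - y‖ = ε := by
  by_cases hne : ∃ x y : X, ‖x‖ = 1 ∧ ‖y‖ = 1 ∧ ‖x - y‖ = ε
  · exact Or.inr hne
  · left
    have hempty : {d : ℝ | ∃ x y : X, ‖x‖ = 1 ∧ ‖y‖ = 1 ∧ ‖x - y‖ = ε ∧ d = 1 - ‖x + y‖ / 2}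
        = ∅ := by
      ext d
      simp only [Set.mem_ofPred_eq, Set.mem_empty_iff_false, iff_false]
      rintro ⟨x, y, hx, hy, hxy, -⟩
      exact hne ⟨x, y, hx, hy, hxy⟩
    rw [modConv, hempty, Real.sInf_empty]

variable [NormedSpace ℝ X]

/-- The distance from a point `b` of the unit ball to a unit vector `x` increases when `x` is
rotated away from `b`. -/
lemma norm_sub_le_norm_sub_of_mem_cone {x x' b : X} (hx : ‖x‖ = 1) (hx' : ‖x'‖ = 1)
    (hb : ‖b‖ ≤ 1) {α β : ℝ} (hα : 0 ≤ α) (hβ : 0 ≤ β) (h : x = α • x' + β • b) :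
    ‖x - b‖ ≤ ‖x' - b‖ := by
  have hpos : 0 < α + β := by
    rcases (add_nonneg hα hβ).lt_or_eq with h0 | h0
    · exact h0
    · have h1 : α = 0 := by linarith
      have h2 : β = 0 := by linarith
      simp [h, h1, h2] at hx
  set s : ℝ := 1 / (α + β) with hs
  have hs0 : 0 < s := by positivity
  have hsum : s * α + s * β = 1 := by rw [hs]; field_simp
  have hsα : 0 ≤ s * α := by positivity
  have hsβ : 0 ≤ s * β := by positivity
  have hz : s • x = (s * α) • x' + (s * β) • b := by rw [h, smul_add, smul_smul, smul_smul]
  have hs1 : s ≤ 1 := by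
    have h1 : ‖s • x‖ ≤ (s * α) * 1 + (s * β) * 1 := by
      rw [hz]
      refine (norm_add_le _ _).trans ?_
      rw [norm_smul, norm_smul, Real.norm_of_nonneg hsα, Real.norm_of_nonneg hsβ, hx']
      gcongr
    rw [norm_smul, Real.norm_of_nonneg hs0.le, hx] at h1
    linarith
  have e1 : ‖x - s • x‖ = 1 - s := by
    rw [show x - s • x = (1 - s) • x by module, norm_smul, hx,
      Real.norm_of_nonneg (by linarith), mul_one]
  have e2 : ‖s • x - b‖ = s * α * ‖x' - b‖ := by
    rw [hz, show (s * β) = 1 - s * α by linarith,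
      show (s * α) • x' + (1 - s * α) • b - b = (s * α) • (x' - b) by module, norm_smul,
      Real.norm_of_nonneg hsα]
  have e3 : ‖x' - s • x‖ = s * β * ‖x' - b‖ := by
    rw [hz, show (s * α) = 1 - s * β by linarith,
      show x' - ((1 - s * β) • x' + (s * β) • b) = (s * β) • (x' - b) by module, norm_smul,
      Real.norm_of_nonneg hsβ]
  have e4 : 1 - s ≤ ‖x' - s • x‖ := by
    have := norm_sub_norm_le x' (s • x)
    rwa [norm_smul, hx, hx', Real.norm_of_nonneg hs0.le, mul_one] at this
  calc ‖x - b‖ ≤ ‖x - s • x‖ + ‖s • x - b‖ := norm_sub_le_norm_sub_add_norm_sub _ _ _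
    _ ≤ s * β * ‖x' - b‖ + s * α * ‖x' - b‖ := by rw [e1, e2]; linarith
    _ = ‖x' - b‖ := by rw [← add_mul, add_comm, hsum, one_mul]

lemma exists_norm_eq_one_norm_add_smul [Nontrivial X] (w : X) :
    ∃ v : X, ‖v‖ = 1 ∧ ∀ c : ℝ, 0 ≤ c → ‖w + c • v‖ = ‖w‖ + c := by
  obtain rfl | hw := eq_or_ne w 0
  · obtain ⟨v, hv⟩ := exists_norm_eq X zero_le_one
    exact ⟨v, hv, fun c hc ↦ by simp [norm_smul, hv, abs_of_nonneg hc]⟩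
  · have hw' : 0 < ‖w‖ := norm_pos_iff.2 hw
    refine ⟨‖w‖⁻¹ • w, ?_, fun c hc ↦ ?_⟩
    · rw [norm_smul, norm_inv, norm_norm, inv_mul_cancel₀ hw'.ne']
    · rw [show w + c • ‖w‖⁻¹ • w = (1 + c * ‖w‖⁻¹) • w by module, norm_smul,
        Real.norm_of_nonneg (by positivity)]
      field_simp

/-- A chord with an endpoint on the unit sphere obeys the bound given by the modulus. -/
lemma norm_sub_half_le_of_norm_eq_one {x a : X} (hx : ‖x‖ = 1) (hxa : ‖x - a‖ ≤ 1) :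
    ‖x - (1 / 2 : ℝ) • a‖ ≤ 1 - modConv X ‖a‖ := by
  have ha2 : ‖a‖ ≤ 2 := by
    have := norm_sub_le x (x - a)
    rw [sub_sub_cancel] at this
    linarith
  have hmid : ‖x - (1 / 2 : ℝ) • a‖ ≤ 1 := by
    rw [show x - (1 / 2 : ℝ) • a = (1 / 2 : ℝ) • (x + (x - a)) by module, norm_smul]
    have := norm_add_le x (x - a)
    norm_num
    linarith
  rcases modConv_eq_zero_or_exists (X := X) ‖a‖ with h0 | ⟨p, q, hp, hq, hpq⟩
  · rw [h0]; linarith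
  obtain rfl | ha := eq_or_ne a 0
  · have := modConv_le hx hx
    rw [show x + x = (2 : ℝ) • x by module, norm_smul, hx] at this
    simp only [sub_self] at this
    norm_num at this ⊢
    linarith
  have ha0 : 0 < ‖a‖ := norm_pos_iff.2 ha
  have hhalf : ‖(1 / 2 : ℝ) • a‖ = ‖a‖ / 2 := by
    rw [norm_smul]; norm_num; ring
  by_cases hxe : x = ‖a‖⁻¹ • a
  · have h1 := modConv_le hp hq
    rw [hpq] at h1
    have h2 : ‖x - (1 / 2 : ℝ) • a‖ = 1 - ‖a‖ / 2 := by
      have h3 : 1 / 2 ≤ ‖a‖⁻¹ := by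
        rw [one_div]; exact inv_anti₀ ha0 ha2
      rw [hxe, ← sub_smul, norm_smul, Real.norm_of_nonneg (by linarith), sub_mul,
        inv_mul_cancel₀ ha0.ne']
      ring
    have h4 : 2 ≤ ‖p + q‖ + ‖a‖ := by
      have := norm_add_le (p + q) (p - q)
      rw [hpq, show p + q + (p - q) = (2 : ℝ) • p by module, norm_smul, hp] at this
      norm_num at this
      exact this
    linarith
  · set e : X := ‖a‖⁻¹ • a with he
    have hen : ‖e‖ = 1 := by rw [he, norm_smul, norm_inv, norm_norm, inv_mul_cancel₀ ha0.ne']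
    have hae : a = ‖a‖ • e := by rw [he, smul_smul, mul_inv_cancel₀ ha0.ne', one_smul]
    have hne : ∀ τ ∈ Set.Icc (0 : ℝ) 1, (1 - τ) • x - τ • e ≠ 0 := by
      rintro τ ⟨hτ0, hτ1⟩ h0
      have h1 : (1 - τ) • x = τ • e := sub_eq_zero.1 h0
      have h2 := congrArg norm h1
      rw [norm_smul, norm_smul, hx, hen, Real.norm_of_nonneg (by linarith),
        Real.norm_of_nonneg hτ0] at h2
      have h3 : τ = 1 / 2 := by linarith
      rw [h3, show (1 - 1 / 2 : ℝ) = 1 / 2 by norm_num] at h1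
      exact hxe (smul_right_injective X (by norm_num : (1 / 2 : ℝ) ≠ 0) h1)
    set m : ℝ → X := fun τ ↦ (1 - τ) • x - τ • e with hm
    have hmc : Continuous m := by fun_prop
    have hcont : ContinuousOn (fun τ ↦ ‖‖m τ‖⁻¹ • m τ - a‖) (Set.Icc (0 : ℝ) 1) := by
      refine ContinuousOn.norm (ContinuousOn.sub (ContinuousOn.smul ?_ hmc.continuousOn)
        continuousOn_const)
      exact hmc.norm.continuousOn.inv₀ fun τ hτ ↦ norm_ne_zero_iff.2 (hne τ hτ)
    have hend : ‖‖m 1‖⁻¹ • m 1 - a‖ = 1 + ‖a‖ := by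
      have h1 : m 1 = -e := by simp [hm]
      have h2 : -e - a = -((1 + ‖a‖) • e) := by
        rw [add_smul, ← hae]
        module
      rw [h1, norm_neg, hen, inv_one, one_smul, h2, norm_neg, norm_smul, hen,
        Real.norm_of_nonneg (by positivity), mul_one]
    obtain ⟨τ, ⟨hτ0, hτ1⟩, hτ⟩ : (1 : ℝ) ∈ (fun τ ↦ ‖‖m τ‖⁻¹ • m τ - a‖) '' Set.Icc 0 1 := by
      refine intermediate_value_Icc zero_le_one hcont ⟨?_, ?_⟩
      · simpa [hm, hx] using hxa
      · simp only [hend]; linarith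
    simp only at hτ
    have hτlt : τ < 1 := by
      refine lt_of_le_of_ne hτ1 ?_
      rintro rfl
      linarith
    have hmpos : 0 < ‖m τ‖ := norm_pos_iff.2 (hne τ ⟨hτ0, hτ1⟩)
    set x' : X := ‖m τ‖⁻¹ • m τ with hx'
    have hx'n : ‖x'‖ = 1 := by
      rw [hx', norm_smul, norm_inv, norm_norm, inv_mul_cancel₀ hmpos.ne']
    have hmx : ‖m τ‖ • x' = (1 - τ) • x - τ • e := by
      rw [hx', smul_smul, mul_inv_cancel₀ hmpos.ne', one_smul]
    have h1τ : 0 < 1 - τ := by linarith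
    have hcone : x = ((1 - τ)⁻¹ * ‖m τ‖) • x' +
        ((1 - τ)⁻¹ * τ * ‖a‖⁻¹ * 2) • (1 / 2 : ℝ) • a := by
      rw [mul_smul, hmx, he, smul_sub, smul_smul, inv_mul_cancel₀ h1τ.ne']
      module
    have hle : ‖x - (1 / 2 : ℝ) • a‖ ≤ ‖x' - (1 / 2 : ℝ) • a‖ :=
      norm_sub_le_norm_sub_of_mem_cone hx hx'n (by linarith) (by positivity) (by positivity) hcone
    have hδ := modConv_le hx'n hτ
    rw [sub_sub_cancel, show x' + (x' - a) = (2 : ℝ) • (x' - (1 / 2 : ℝ) • a) by module,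
      norm_smul] at hδ
    norm_num at hδ hle ⊢
    linarith

/-- The bound defining the modulus of convexity on the unit sphere persists in the unit ball. -/
lemma norm_sub_half_le_of_norm_le_one {x a : X} (hx : ‖x‖ ≤ 1) (hxa : ‖x - a‖ ≤ 1) :
    ‖x - (1 / 2 : ℝ) • a‖ ≤ 1 - modConv X ‖a‖ := by
  rcases subsingleton_or_nontrivial X with hX | hX
  · have h0 : modConv X ‖a‖ = 0 := by
      rcases modConv_eq_zero_or_exists (X := X) ‖a‖ with h0 | ⟨p, q, hp, -, -⟩
      · exact h0
      · simp [Subsingleton.elim p 0] at hp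
    rw [h0, Subsingleton.elim (x - (1 / 2 : ℝ) • a) 0]
    simp
  obtain ⟨v, hv, hwv⟩ := exists_norm_eq_one_norm_add_smul (x - (1 / 2 : ℝ) • a)
  obtain ⟨c, ⟨hc0, -⟩, hc⟩ : (1 : ℝ) ∈
      (fun c : ℝ ↦ max ‖x + c • v‖ ‖x - a + c • v‖) '' Set.Icc 0 2 := by
    refine intermediate_value_Icc zero_le_two (by fun_prop) ⟨by simp [hx, hxa], ?_⟩
    refine le_max_of_le_left ?_
    have := norm_sub_le (x + (2 : ℝ) • v) x
    rw [add_sub_cancel_left, norm_smul, hv] at this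
    norm_num at this
    linarith
  simp only at hc
  have hmid := hwv c hc0
  rcases max_choice ‖x + c • v‖ ‖x - a + c • v‖ with hmax | hmax
  · have := norm_sub_half_le_of_norm_eq_one (x := x + c • v) (a := a) (hmax ▸ hc)
      (by rw [← hc, show x + c • v - a = x - a + c • v by abel]; exact le_max_right _ _)
    rw [show x + c • v - (1 / 2 : ℝ) • a = x - (1 / 2 : ℝ) • a + c • v by abel, hmid] at this
    linarith
  · have := norm_sub_half_le_of_norm_eq_one (x := -(x - a + c • v)) (a := a)
      (by rw [norm_neg]; exact hmax ▸ hc)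
      (by
        rw [← hc, show -(x - a + c • v) - a = -(x + c • v) by abel, norm_neg]
        exact le_max_left _ _)
    rw [show -(x - a + c • v) - (1 / 2 : ℝ) • a = -(x - (1 / 2 : ℝ) • a + c • v) by module,
      norm_neg, hmid] at this
    linarith

/-- If every chord `a` of the unit ball has its midpoint at depth at least `D`, then every chord
`t • a`, `1 ≤ t`, of a smaller ball has its midpoint at depth at least `t * D`. -/
lemma mul_le_sub_norm_sub_half [Nontrivial X] {a : X} {D : ℝ}
    (hD : ∀ x : X, ‖x‖ ≤ 1 → ‖x - a‖ ≤ 1 → ‖x - (1 / 2 : ℝ) • a‖ ≤ 1 - D)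
    {x : X} {r t : ℝ} (hr : r ≤ 1) (ht : 1 ≤ t) (hx : ‖x‖ ≤ r) (hxa : ‖x - t • a‖ ≤ r) :
    t * D ≤ r - ‖x - (t / 2) • a‖ := by
  have ht0 : 0 < t := by linarith
  have ht1 : t⁻¹ ≤ 1 := inv_le_one_of_one_le₀ ht
  have hti : 0 < t⁻¹ := by positivity
  set w : X := x - (t / 2) • a with hw
  have hwr : ‖w‖ ≤ r := by
    rw [hw, show x - (t / 2) • a = (1 / 2 : ℝ) • (x + (x - t • a)) by module, norm_smul]
    have := norm_add_le x (x - t • a)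
    norm_num
    linarith
  obtain ⟨v, hv, hwv⟩ := exists_norm_eq_one_norm_add_smul w
  set ρ : ℝ := t⁻¹ * r + (1 - t⁻¹) * ‖w‖ with hρ
  have hρr : ρ ≤ r := by
    have : 0 ≤ (1 - t⁻¹) * (r - ‖w‖) := mul_nonneg (by linarith) (by linarith)
    rw [hρ]; linarith
  have hball : ∀ z : X, ‖z‖ ≤ r → ‖t⁻¹ • z + (1 - t⁻¹) • w + (1 - ρ) • v‖ ≤ 1 := by
    intro z hz
    have h1 : ‖t⁻¹ • z + (1 - t⁻¹) • w + (1 - ρ) • v‖ ≤ t⁻¹ * r + (1 - t⁻¹) * ‖w‖ + (1 - ρ) := by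
      refine norm_add₃_le.trans ?_
      rw [norm_smul, norm_smul, norm_smul, hv, Real.norm_of_nonneg hti.le,
        Real.norm_of_nonneg (by linarith : 0 ≤ 1 - t⁻¹),
        Real.norm_of_nonneg (by linarith : 0 ≤ 1 - ρ), mul_one]
      gcongr
    linarith
  have key := hD (t⁻¹ • x + (1 - t⁻¹) • w + (1 - ρ) • v) (hball x hx) (by
    rw [show t⁻¹ • x + (1 - t⁻¹) • w + (1 - ρ) • v - a =
      t⁻¹ • (x - t • a) + (1 - t⁻¹) • w + (1 - ρ) • v by
        rw [smul_sub t⁻¹ x, smul_smul t⁻¹ t, inv_mul_cancel₀ ht0.ne']; module]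
    exact hball _ hxa)
  rw [show t⁻¹ • x + (1 - t⁻¹) • w + (1 - ρ) • v - (1 / 2 : ℝ) • a = w + (1 - ρ) • v by
      have hxw : x = w + (t / 2) • a := by rw [hw]; abel
      rw [hxw, smul_add, smul_smul t⁻¹, show t⁻¹ * (t / 2) = 1 / 2 by field_simp]; module,
    hwv _ (by linarith)] at key
  have h2 : D ≤ t⁻¹ * (r - ‖w‖) := by rw [hρ] at key; linarith
  calc t * D ≤ t * (t⁻¹ * (r - ‖w‖)) := by gcongr
    _ = r - ‖w‖ := by rw [← mul_assoc, mul_inv_cancel₀ ht0.ne', one_mul]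

lemma DeltaConv.exists_pos_eventually_add_le [UniformConvexSpace X] {u : ℕ → X}
    (hu : ∀ k, ‖u k‖ ≤ 1) {a : X} (ha : a ≠ 0) (h : DeltaConv u a) :
    ∃ c > 0, ∀ᶠ k in atTop, ‖u k - a‖ + c ≤ ‖u k‖ := by
  have ha0 : 0 < ‖a‖ := norm_pos_iff.2 ha
  obtain ⟨δ, hδ, hconv⟩ := exists_forall_closed_ball_dist_add_le_two_sub X (half_pos ha0)
  refine ⟨‖a‖ * δ / 8, by positivity, ?_⟩
  set η : ℝ := min 1 (‖a‖ * δ / 16) with hη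
  have hη0 : 0 < η := by positivity
  have hη1 : η ≤ 1 := min_le_left _ _
  have hη2 : η ≤ ‖a‖ * δ / 16 := min_le_right _ _
  filter_upwards [h 0 η hη0, h ((1 / 2 : ℝ) • a) η hη0] with k h0 h1
  rw [sub_zero] at h0
  have hk := hu k
  generalize u k = p at *
  set R : ℝ := max ‖p‖ ‖p - a‖ with hR
  have hpR : ‖p‖ ≤ R := le_max_left _ _
  have hpaR : ‖p - a‖ ≤ R := le_max_right _ _
  have hRη : R ≤ ‖p‖ + η := max_le (by linarith) h0
  have haR : ‖a‖ ≤ 2 * R := by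
    have := norm_sub_le p (p - a)
    rw [sub_sub_cancel] at this
    linarith
  have hR0 : 0 < R := by linarith
  have hscale : ∀ z : X, ‖R⁻¹ • z‖ = ‖z‖ / R := fun z ↦ by
    rw [norm_smul, norm_inv, Real.norm_of_nonneg hR0.le, inv_mul_eq_div]
  have key := hconv (x := R⁻¹ • p) (by rw [hscale]; exact (div_le_one hR0).2 hpR)
    (y := R⁻¹ • (p - a)) (by rw [hscale]; exact (div_le_one hR0).2 hpaR) (by
      rw [← smul_sub, sub_sub_cancel, hscale]
      exact div_le_div_of_nonneg_left ha0.le hR0 (by linarith))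
  rw [← smul_add, hscale, div_le_iff₀ hR0,
    show p + (p - a) = (2 : ℝ) • (p - (1 / 2 : ℝ) • a) by module, norm_smul,
    Real.norm_of_nonneg zero_le_two] at key
  have hRδ : ‖a‖ * δ ≤ 2 * R * δ := by gcongr
  linarith

end

theorem stmt_5 {X : Type*} [NormedAddCommGroup X] [NormedSpace ℝ X]
    [UniformConvexSpace X] [CompleteSpace X]
    (u : ℕ → X) (hu : ∀ k, ‖u k‖ ≤ 1) (a : X) (h : DeltaConv u a) :
    ‖a‖ < 2 ∧ ∀ᶠ k in atTop, ‖u k - a‖ + modConv X ‖a‖ ≤ ‖u k‖ := by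
  obtain rfl | ha := eq_or_ne a 0
  · refine ⟨by simp, Eventually.of_forall fun k ↦ ?_⟩
    rcases modConv_eq_zero_or_exists (X := X) ‖(0 : X)‖ with h0 | ⟨x, -, hx, -, -⟩
    · rw [h0]; simp
    · have h1 := modConv_le hx hx
      rw [sub_self, show x + x = (2 : ℝ) • x by module, norm_smul, hx] at h1
      norm_num at h1 ⊢
      linarith
  have ha0 : 0 < ‖a‖ := norm_pos_iff.2 ha
  have : Nontrivial X := ⟨a, 0, ha⟩
  obtain ⟨δ, hδ, hconv⟩ := exists_forall_closed_ball_dist_add_le_two_sub X ha0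
  set D : ℝ := max (modConv X ‖a‖) (δ / 2) with hDdef
  have hD0 : 0 < D := lt_max_of_lt_right (half_pos hδ)
  have hD : ∀ x : X, ‖x‖ ≤ 1 → ‖x - a‖ ≤ 1 → ‖x - (1 / 2 : ℝ) • a‖ ≤ 1 - D := by
    intro x hx hxa
    have h1 := norm_sub_half_le_of_norm_le_one hx hxa
    have h2 := hconv hx hxa (by rw [sub_sub_cancel])
    rw [show x + (x - a) = (2 : ℝ) • (x - (1 / 2 : ℝ) • a) by module, norm_smul,
      Real.norm_of_nonneg zero_le_two] at h2
    rcases max_choice (modConv X ‖a‖) (δ / 2) with h3 | h3 <;> rw [hDdef, h3] <;> linarith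
  obtain ⟨c, hc, hgap⟩ := h.exists_pos_eventually_add_le hu ha
  set t : ℝ := 1 + c / ‖a‖ with ht
  have ht1 : 0 < t - 1 := by rw [ht, add_sub_cancel_left]; positivity
  have main : ∀ᶠ k in atTop, ‖u k - a‖ + D ≤ ‖u k‖ := by
    filter_upwards [hgap, h ((t / 2) • a) ((t - 1) * D) (by positivity)] with k h1 h2
    have h3 : ‖u k - t • a‖ ≤ ‖u k‖ := by
      have h4 := norm_sub_le (u k - a) ((t - 1) • a)
      rw [show u k - a - (t - 1) • a = u k - t • a by module, norm_smul,
        Real.norm_of_nonneg ht1.le, ht, add_sub_cancel_left, div_mul_cancel₀ _ ha0.ne'] at h4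
      exact h4.trans h1
    have h5 := mul_le_sub_norm_sub_half hD (hu k) (by linarith) le_rfl h3
    linarith
  refine ⟨?_, main.mono fun k hk ↦ le_trans (by gcongr; exact le_max_left _ _) hk⟩
  obtain ⟨k, hk⟩ := main.exists
  have h1 := norm_sub_le (u k) (u k - a)
  rw [sub_sub_cancel] at h1
  linarith [hu k]
end

section
/- For every real number p ≥ 3 and every real number t, one has the inequality |1 + t|^p ≥ 1 + |t|^p + p·|t|^{p−2}·t + p·t. -/
/-- The case `0 ≤ t ≤ 1`, by Bernoulli's inequality with exponent `p - 2`. -/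
lemma one_add_rpow_lower_bound {p t : ℝ} (hp : 3 ≤ p) (h0 : 0 ≤ t) (h1 : t ≤ 1) :
    1 + t ^ p + p * t ^ (p - 1) + p * t ≤ (1 + t) ^ p := by
  have hb : 1 + (p - 2) * t ≤ (1 + t) ^ (p - 2) :=
    one_add_mul_self_le_rpow_one_add (by linarith) (by linarith)
  have hsplit : (1 + t) ^ p = (1 + t) ^ (p - 2) * (1 + t) ^ 2 := by
    rw [← Real.rpow_natCast, ← Real.rpow_add (by linarith)]
    norm_num
  have h2 : t ^ (p - 1) ≤ t ^ 2 := by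
    rw [← Real.rpow_natCast]
    exact Real.rpow_le_rpow_of_exponent_ge' h0 h1 (by norm_num) (by push_cast; linarith)
  have h3 : t ^ p ≤ t ^ 3 := by
    rw [← Real.rpow_natCast]
    exact Real.rpow_le_rpow_of_exponent_ge' h0 h1 (by norm_num) (by push_cast; linarith)
  have hmul := mul_le_mul_of_nonneg_right hb (sq_nonneg (1 + t))
  have h4 : p * t ^ (p - 1) ≤ p * t ^ 2 := by gcongr
  have h5 : 0 ≤ (p - 3) * t ^ 2 := mul_nonneg (by linarith) (by positivity)
  have h6 : 0 ≤ (p - 3) * t ^ 3 := mul_nonneg (by linarith) (by positivity)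
  rw [hsplit]
  linarith

/-- The case `-1 ≤ t < 0`, written for `s = -t`. -/
lemma one_sub_rpow_lower_bound {p s : ℝ} (hp : 1 ≤ p) (h0 : 0 < s) (h1 : s ≤ 1) :
    1 + s ^ p - p * s ^ (p - 1) - p * s ≤ (1 - s) ^ p := by
  have hb : 1 + p * (-s) ≤ (1 + -s) ^ p :=
    one_add_mul_self_le_rpow_one_add (by linarith) hp
  have hsplit : s ^ p = s ^ (p - 1) * s := by
    rw [← Real.rpow_add_one h0.ne', sub_add_cancel]
  have hnonneg : 0 ≤ s ^ (p - 1) * (p - s) :=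
    mul_nonneg (Real.rpow_nonneg h0.le _) (by linarith)
  rw [← sub_eq_add_neg] at hb
  linarith

lemma abs_one_add_rpow_lower_bound_of_abs_le_one {p t : ℝ} (hp : 3 ≤ p) (ht : |t| ≤ 1) :
    1 + |t| ^ p + p * (Real.sign t * |t| ^ (p - 1)) + p * t ≤ |1 + t| ^ p := by
  obtain ⟨hl, hu⟩ := abs_le.mp ht
  rw [abs_of_nonneg (by linarith : 0 ≤ 1 + t)]
  rcases lt_trichotomy t 0 with h | rfl | h
  · have := one_sub_rpow_lower_bound (by linarith : 1 ≤ p) (neg_pos.mpr h) (by linarith)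
    rw [sub_neg_eq_add] at this
    rw [abs_of_neg h, Real.sign_of_neg h]
    linarith
  · simp [Real.zero_rpow (by linarith : p ≠ 0)]
  · rw [abs_of_pos h, Real.sign_of_pos h, one_mul]
    exact one_add_rpow_lower_bound hp h.le hu

/-- For every real `p ≥ 3` and every real `t`:
`|1 + t|^p ≥ 1 + |t|^p + p·sign(t)·|t|^{p-1} + p·t`,
where `sign(t)·|t|^{p-1}` is the odd power-type function `|t|^{p-2}·t`. -/
theorem stmt_12 (p t : ℝ) (hp : 3 ≤ p) :
    1 + |t| ^ p + p * (Real.sign t * |t| ^ (p - 1)) + p * t ≤ |1 + t| ^ p := by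
  rcases le_total |t| 1 with ht | ht
  · exact abs_one_add_rpow_lower_bound_of_abs_le_one hp ht
  have hpos : 0 < |t| := by linarith
  have hne : t ≠ 0 := abs_pos.mp hpos
  have key := mul_le_mul_of_nonneg_left
    (abs_one_add_rpow_lower_bound_of_abs_le_one (t := t⁻¹) hp
      (by rw [abs_inv]; exact inv_le_one_of_one_le₀ ht)) (Real.rpow_nonneg hpos.le p)
  rw [← Real.mul_rpow hpos.le (abs_nonneg _), ← abs_mul, mul_add t, mul_one,
    mul_inv_cancel₀ hne, add_comm t 1, abs_inv, Real.inv_rpow hpos.le,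
    Real.inv_rpow hpos.le, Real.sign_inv] at key
  have hsplit : |t| ^ p = |t| ^ (p - 1) * |t| := by
    rw [← Real.rpow_add_one hpos.ne', sub_add_cancel]
  have hinv : |t| ^ p * (|t| ^ p)⁻¹ = 1 := mul_inv_cancel₀ (Real.rpow_pos_of_pos hpos p).ne'
  have hlinear : |t| ^ p * (Real.sign t * (|t| ^ (p - 1))⁻¹) = t := by
    have hsign : Real.sign t * |t| = t := by
      rcases hne.lt_or_gt with h | h
      · rw [abs_of_neg h, Real.sign_of_neg h]; ring
      · rw [abs_of_pos h, Real.sign_of_pos h, one_mul]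
    have hq := (Real.rpow_pos_of_pos hpos (p - 1)).ne'
    rw [hsplit]
    field_simp
    linarith
  have hpower : |t| ^ p * t⁻¹ = Real.sign t * |t| ^ (p - 1) := by
    rw [hsplit]
    rcases hne.lt_or_gt with h | h
    · rw [abs_of_neg h, Real.sign_of_neg h]; field_simp
    · rw [abs_of_pos h, Real.sign_of_pos h]; field_simp
  calc 1 + |t| ^ p + p * (Real.sign t * |t| ^ (p - 1)) + p * t
      = |t| ^ p * (1 + (|t| ^ p)⁻¹ + p * (Real.sign t * (|t| ^ (p - 1))⁻¹) + p * t⁻¹) := by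
        linear_combination -hinv - p * hlinear - p * hpower
    _ ≤ |1 + t| ^ p := key
end

section
/- Let X be a uniformly convex and uniformly smooth Banach space, and let (g_k) be a sequence of bijective linear isometries of X such that (g_k^{-1}) converges in the strong operator topology (necessarily to a linear isometry h). If (x_k) is a bounded sequence in X with x_k ⇁ 0 (Δ-convergence), then g_k x_k ⇁ 0. -/
open Filter Topology

/-- `X` is uniformly smooth: for every `ε > 0` there is `η > 0` such that
`‖x‖ = 1` and `‖y‖ ≤ η` imply `‖x + y‖ + ‖x - y‖ ≤ 2 + ε‖y‖`;
equivalently, the dual of `X` is uniformly convex. -/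
def UnifSmooth (X : Type*) [NormedAddCommGroup X] : Prop :=
  ∀ ε > (0 : ℝ), ∃ η > (0 : ℝ), ∀ x y : X, ‖x‖ = 1 → ‖y‖ ≤ η →
    ‖x + y‖ + ‖x - y‖ ≤ 2 + ε * ‖y‖

theorem stmt_16 {X : Type*} [NormedAddCommGroup X] [NormedSpace ℝ X]
    [UniformConvexSpace X] [CompleteSpace X] (hsm : UnifSmooth X)
    (g : ℕ → (X ≃ₗᵢ[ℝ] X))
    (hg : ∀ v : X, ∃ l : X, Tendsto (fun k => (g k).symm v) atTop (𝓝 l))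
    (x : ℕ → X) (hb : ∃ C : ℝ, ∀ k, ‖x k‖ ≤ C) (hx : DeltaConv x 0) :
    DeltaConv (fun k => g k (x k)) 0 := by
  intro y ε hε
  obtain ⟨l, hl⟩ := hg y
  filter_upwards [hx l (ε / 2) (half_pos hε), Metric.tendsto_nhds.1 hl (ε / 2) (half_pos hε)]
    with k hk hkl
  have h0 : ‖g k (x k) - y‖ = ‖x k - (g k).symm y‖ := by
    rw [← (g k).norm_map (x k - (g k).symm y), map_sub, (g k).apply_symm_apply]
  rw [dist_eq_norm] at hkl
  have h1 := norm_sub_le_norm_sub_add_norm_sub (x k) ((g k).symm y) l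
  rw [sub_zero] at hk
  rw [sub_zero, (g k).norm_map, h0]
  linarith
end

section
/- Let X be a Banach space and let (x_k) be a bounded sequence in X. Then (x_k) has a regular subsequence, i.e. a subsequence (v_n) such that every further subsequence of (v_n) has the same asymptotic radius as (v_n). -/
open Filter Topology

/-- The asymptotic radius of a bounded sequence `v` in a Banach space:
`rad (v) = inf_y limsup ‖v n - y‖`. -/
noncomputable def asympRadius {X : Type*} [NormedAddCommGroup X] (v : ℕ → X) : ℝ :=
  ⨅ y : X, limsup (fun n => ‖v n - y‖) atTop

/-- A functional on strictly increasing sequences of indices that is bounded below and decreases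
when passing to sequences that are eventually finer attains, along some sequence, a value that
no subsequence improves. -/
theorem exists_strictMono_forall_le_comp (f : (ℕ → ℕ) → ℝ) (h0 : ∀ a, StrictMono a → 0 ≤ f a)
    (hf : ∀ a b, StrictMono a → StrictMono b → map a atTop ≤ map b atTop → f a ≤ f b) :
    ∃ φ : ℕ → ℕ, StrictMono φ ∧ ∀ ψ, StrictMono ψ → f φ ≤ f (φ ∘ ψ) := by
  have step : ∀ (k : ℕ) (b : {b : ℕ → ℕ // StrictMono b}), ∃ a : {a : ℕ → ℕ // StrictMono a},
      map a.1 atTop ≤ map b.1 atTop ∧ ∀ c, StrictMono c → map c atTop ≤ map b.1 atTop →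
        f a.1 ≤ f c + 1 / ((k : ℝ) + 1) := by
    intro k b
    let S := f '' {c | StrictMono c ∧ map c atTop ≤ map b.1 atTop}
    have hne : S.Nonempty := ⟨f b.1, b.1, ⟨b.2, le_rfl⟩, rfl⟩
    have hbdd : BddBelow S := ⟨0, by rintro _ ⟨c, hc, rfl⟩; exact h0 c hc.1⟩
    obtain ⟨_, ⟨a, ⟨ha, hab⟩, rfl⟩, hlt⟩ :=
      exists_lt_of_csInf_lt hne (lt_add_of_pos_right (sInf S) (Nat.one_div_pos_of_nat (n := k)))
    refine ⟨⟨a, ha⟩, hab, fun c hc hcb => hlt.le.trans ?_⟩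
    gcongr
    exact csInf_le hbdd ⟨c, ⟨hc, hcb⟩, rfl⟩
  choose next hnext_le hnext using step
  let s : ℕ → {a : ℕ → ℕ // StrictMono a} := fun n => Nat.rec ⟨id, strictMono_id⟩ next n
  let l : ℕ → Filter ℕ := fun k => map (s k).1 atTop
  have hl : Antitone l := antitone_nat_of_succ_le fun k => hnext_le k (s k)
  have : (⨅ k, l k).NeBot := iInf_neBot_of_directed' hl.directed_ge fun k => inferInstance
  obtain ⟨d, hd⟩ := exists_seq_tendsto (⨅ k, l k)
  have hd_top : Tendsto d atTop atTop := hd.mono_right ((iInf_le l 0).trans (s 0).2.tendsto_atTop)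
  obtain ⟨θ, hθ, hdθ⟩ := strictMono_subseq_of_tendsto_atTop hd_top
  have hle : ∀ k, Tendsto (d ∘ θ) atTop (l k) := fun k =>
    (hd.comp hθ.tendsto_atTop).mono_right (iInf_le l k)
  refine ⟨d ∘ θ, hdθ, fun ψ hψ => ?_⟩
  have key : ∀ k : ℕ, f (d ∘ θ) ≤ f ((d ∘ θ) ∘ ψ) + 1 / ((k : ℝ) + 1) := fun k =>
    (hf _ _ hdθ (s (k + 1)).2 (hle (k + 1))).trans
      (hnext k (s k) _ (hdθ.comp hψ) ((hle k).comp hψ.tendsto_atTop))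
  refine ge_of_tendsto' (x := atTop) ?_ key
  simpa using tendsto_one_div_add_atTop_nhds_zero_nat.const_add (f ((d ∘ θ) ∘ ψ))

theorem isBoundedUnder_le_norm_sub {X : Type*} [NormedAddCommGroup X] {x : ℕ → X} {C : ℝ}
    (hC : ∀ k, ‖x k‖ ≤ C) (l : Filter ℕ) (y : X) :
    l.IsBoundedUnder (· ≤ ·) fun n => ‖x n - y‖ :=
  isBoundedUnder_of ⟨C + ‖y‖, fun n => (norm_sub_le _ _).trans (by gcongr; exact hC n)⟩

theorem isCoboundedUnder_le_norm_sub {X : Type*} [NormedAddCommGroup X] (x : ℕ → X)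
    (l : Filter ℕ) [l.NeBot] (y : X) : l.IsCoboundedUnder (· ≤ ·) fun n => ‖x n - y‖ :=
  IsBoundedUnder.isCoboundedUnder_le (isBoundedUnder_of ⟨0, fun _ => norm_nonneg _⟩)

theorem limsup_norm_sub_nonneg {X : Type*} [NormedAddCommGroup X] {x : ℕ → X} {C : ℝ}
    (hC : ∀ k, ‖x k‖ ≤ C) (y : X) : 0 ≤ limsup (fun n => ‖x n - y‖) atTop :=
  le_limsup_of_frequently_le (Frequently.of_forall fun _ => norm_nonneg _)
    (isBoundedUnder_le_norm_sub hC atTop y)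

theorem asympRadius_comp_le_of_map_le {X : Type*} [NormedAddCommGroup X] {x : ℕ → X} {C : ℝ}
    (hC : ∀ k, ‖x k‖ ≤ C) {a b : ℕ → ℕ} (hab : map a atTop ≤ map b atTop) :
    asympRadius (x ∘ a) ≤ asympRadius (x ∘ b) := by
  refine ciInf_mono ⟨0, ?_⟩ fun y => ?_
  · rintro _ ⟨y, rfl⟩
    exact limsup_norm_sub_nonneg (fun k => hC (a k)) y
  · exact limsup_le_limsup_of_le (u := fun n => ‖x n - y‖) hab
      (isCoboundedUnder_le_norm_sub x _ y) (isBoundedUnder_le_norm_sub hC _ y)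

theorem stmt_19 {X : Type*} [NormedAddCommGroup X] [NormedSpace ℝ X] [CompleteSpace X]
    (x : ℕ → X) (hb : ∃ C : ℝ, ∀ k, ‖x k‖ ≤ C) :
    ∃ φ : ℕ → ℕ, StrictMono φ ∧
      ∀ ψ : ℕ → ℕ, StrictMono ψ → asympRadius (x ∘ φ ∘ ψ) = asympRadius (x ∘ φ) := by
  obtain ⟨C, hC⟩ := hb
  obtain ⟨φ, hφ, hmin⟩ := exists_strictMono_forall_le_comp (fun a => asympRadius (x ∘ a))
    (fun a _ => Real.iInf_nonneg fun y => limsup_norm_sub_nonneg (fun k => hC (a k)) y)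
    (fun _ _ _ _ hab => asympRadius_comp_le_of_map_le hC hab)
  refine ⟨φ, hφ, fun ψ hψ => le_antisymm (asympRadius_comp_le_of_map_le hC ?_) (hmin ψ hψ)⟩
  rw [← map_map]
  exact map_mono hψ.tendsto_atTop
end
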